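/- If X = (X₁, Y₁, Z₁) is tangent to S^{p-1}(r₁) × S^{p-1}(r₂) × S^{q-1}(r₃) at (x,y,z), then the tangential part PX = P̃X − Σ_{α=1}^3 ⟨P̃X, N_α⟩ N_α equals (Y₁ − (⟨x,Y₁⟩/r₁²)x, X₁ − (⟨y,X₁⟩/r₂²)y, ε Z₁). -/

import Mathlib

open scoped RealInnerProductSpace

noncomputable section

/-- Euclidean space ℝ^n. -/
abbrev Ep (n : ℕ) : Type := EuclideanSpace ℝ (Fin n)

/-- The almost product structure `P̃(x,y,z) = (y, x, ε • z)` on `ℝ^p × ℝ^p × ℝ^q`. -/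
def Pt (p q : ℕ) (ε : ℝ) : Ep p × Ep p × Ep q → Ep p × Ep p × Ep q :=
  fun v => (v.2.1, v.1, ε • v.2.2)

/-- The standard (product / Euclidean) inner product on the triple space. -/
def ip3 {p q : ℕ} (u v : Ep p × Ep p × Ep q) : ℝ :=
  ⟪u.1, v.1⟫ + ⟪u.2.1, v.2.1⟫ + ⟪u.2.2, v.2.2⟫

theorem stmt_16 (p q : ℕ) (hp : 0 < p) (hq : 0 < q) (ε : ℝ) (hε : ε = 1 ∨ ε = -1)
    (r₁ r₂ r₃ : ℝ) (h₁ : 0 < r₁) (h₂ : 0 < r₂) (h₃ : 0 < r₃)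
    (r : ℝ) (hr : r = Real.sqrt (r₁ ^ 2 + r₂ ^ 2))
    (R : ℝ) (hR : R = Real.sqrt (r ^ 2 + r₃ ^ 2))
    (x y : Ep p) (z : Ep q) (hx : ‖x‖ = r₁) (hy : ‖y‖ = r₂) (hz : ‖z‖ = r₃)
    (N₁ N₂ N₃ : Ep p × Ep p × Ep q)
    (hN₁ : N₁ = (1 / R) • ((x, y, z) : Ep p × Ep p × Ep q))
    (hN₂ : N₂ = (1 / R) • (((r₃ / r) • x, (r₃ / r) • y, -((r / r₃) • z)) : Ep p × Ep p × Ep q))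
    (hN₃ : N₃ = (1 / r) • (((r₂ / r₁) • x, -((r₁ / r₂) • y), (0 : Ep q)) : Ep p × Ep p × Ep q))
    (X₁ Y₁ : Ep p) (Z₁ : Ep q)
    (ht1 : ⟪x, X₁⟫ = 0) (ht2 : ⟪y, Y₁⟫ = 0) (ht3 : ⟪z, Z₁⟫ = 0)
    (X PX : Ep p × Ep p × Ep q) (hX : X = ((X₁, Y₁, Z₁) : Ep p × Ep p × Ep q))
    (hPX : PX = Pt p q ε X - ip3 (Pt p q ε X) N₁ • N₁ - ip3 (Pt p q ε X) N₂ • N₂ -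
        ip3 (Pt p q ε X) N₃ • N₃) :
    PX = ((Y₁ - (⟪x, Y₁⟫ / r₁ ^ 2) • x, X₁ - (⟪y, X₁⟫ / r₂ ^ 2) • y, ε • Z₁) :
      Ep p × Ep p × Ep q) := by 
  have hrp : 0 < r := by rw [hr]; positivity
  have hRp : 0 < R := by rw [hR]; positivity
  have hr2 : r ^ 2 = r₁ ^ 2 + r₂ ^ 2 := by rw [hr]; exact Real.sq_sqrt (by positivity)
  have hR2 : R ^ 2 = r₁ ^ 2 + r₂ ^ 2 + r₃ ^ 2 := by
    rw [← hr2, hR]; exact Real.sq_sqrt (by positivity)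
  clear hr hR
  obtain ⟨a, ha⟩ : ∃ a : ℝ, ⟪x, Y₁⟫ = a := ⟨_, rfl⟩
  obtain ⟨b, hb⟩ : ∃ b : ℝ, ⟪y, X₁⟫ = b := ⟨_, rfl⟩
  have ha' : ⟪Y₁, x⟫ = a := by rw [real_inner_comm, ha]
  have hb' : ⟪X₁, y⟫ = b := by rw [real_inner_comm, hb]
  have hz' : ⟪Z₁, z⟫ = 0 := by rw [real_inner_comm, ht3]
  have e1 : ip3 (Pt p q ε X) N₁ = (a + b) / R := by
    subst hX hN₁
    simp only [ip3, Pt, Prod.smul_mk, inner_smul_left, inner_smul_right, ha', hb', hz']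
    ring
  have e2 : ip3 (Pt p q ε X) N₂ = (r₃ / r) * (a + b) / R := by
    subst hX hN₂
    simp only [ip3, Pt, Prod.smul_mk, inner_smul_left, inner_smul_right, inner_neg_right,
      ha', hb', hz']
    ring
  have e3 : ip3 (Pt p q ε X) N₃ = (r₂ / r₁ * a - r₁ / r₂ * b) / r := by
    subst hX hN₃
    simp only [ip3, Pt, Prod.smul_mk, inner_smul_left, inner_smul_right, inner_neg_right,
      inner_zero_right, ha', hb', hz']
    ring
  have hQ : 0 < r₁ ^ 2 + r₂ ^ 2 := by positivity
  have hS : 0 < r₁ ^ 2 + r₂ ^ 2 + r₃ ^ 2 := by positivity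
  have c1 : (a + b) / R * (1 / R) + (r₃ / r) * (a + b) / R * (1 / R * (r₃ / r))
      + (r₂ / r₁ * a - r₁ / r₂ * b) / r * (1 / r * (r₂ / r₁)) = a / r₁ ^ 2 := by
    have : (a + b) / R * (1 / R) + (r₃ / r) * (a + b) / R * (1 / R * (r₃ / r))
      + (r₂ / r₁ * a - r₁ / r₂ * b) / r * (1 / r * (r₂ / r₁)) =
      (a + b) / R ^ 2 * (1 + r₃ ^ 2 / r ^ 2) + (r₂ ^ 2 / r₁ ^ 2 * a - b) / r ^ 2 := by
      field_simp
    rw [this, hr2, hR2]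
    field_simp
    ring
  have c2 : (a + b) / R * (1 / R) + (r₃ / r) * (a + b) / R * (1 / R * (r₃ / r))
      - (r₂ / r₁ * a - r₁ / r₂ * b) / r * (1 / r * (r₁ / r₂)) = b / r₂ ^ 2 := by
    have : (a + b) / R * (1 / R) + (r₃ / r) * (a + b) / R * (1 / R * (r₃ / r))
      - (r₂ / r₁ * a - r₁ / r₂ * b) / r * (1 / r * (r₁ / r₂)) =
      (a + b) / R ^ 2 * (1 + r₃ ^ 2 / r ^ 2) - (a - r₁ ^ 2 / r₂ ^ 2 * b) / r ^ 2 := by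
      field_simp
    rw [this, hr2, hR2]
    field_simp
    ring
  have c3 : (a + b) / R * (1 / R) - (r₃ / r) * (a + b) / R * (1 / R * (r / r₃)) = 0 := by
    field_simp
    ring
  rw [hPX, e1, e2, e3, ha, hb, hN₁, hN₂, hN₃, hX, ← c1, ← c2]
  have hzz : ε • Z₁ = ε • Z₁ -
      ((a + b) / R * (1 / R) - (r₃ / r) * (a + b) / R * (1 / R * (r / r₃))) • z := by
    rw [c3, zero_smul, sub_zero]
  rw [hzz]
  simp only [Pt, Prod.smul_mk, Prod.mk_sub_mk, Prod.mk.injEq]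
  refine ⟨?_, ?_, ?_⟩
  · module
  · module
  · module
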